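/- Fix real numbers t and β with 0 < t < 1, β > 0 and 0 < βt < 1. There exist constants M₀, C, c > 0 such that for all positive integers N and l, if x := (l - η(t)N)/(ρ(t)N^{1/3}) satisfies x ≥ M₀, then 0 ≤ 1 - φ(N, l, t, β) ≤ C e^{-c x^{3/2}}. -/

import Mathlib

open scoped Classical

noncomputable section

/-- Semistandard Young tableaux of shape `μ` with entries in `{1, …, N}`. -/
def SSYTN (N : ℕ) (μ : YoungDiagram) : Type :=
  {T : SemistandardYoungTableau μ // ∀ i j : ℕ, (i, j) ∈ μ → T i j ∈ Finset.Icc 1 N}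

/-- `d_λ(N)`: the number of semistandard Young tableaux of shape `μ`
with entries in `{1, …, N}`. -/
def dCount (N : ℕ) (μ : YoungDiagram) : ℕ := Nat.card (SSYTN N μ)

/-- `f(λ')`: the number of odd columns of `μ`. -/
def oddCols (μ : YoungDiagram) : ℕ :=
  ((Finset.range μ.card).filter fun j => Odd (μ.colLen j)).card

/-- `ℓ(λ)`: the number of rows of `μ` (the length of its first column). -/
def numRows (μ : YoungDiagram) : ℕ := μ.colLen 0

/-- The generating function
`φ(N, l, t, β) = (1-t²)^{N(N-1)/2} (1-βt)^N Σ_{ℓ(λ) ≤ l} t^{|λ|} β^{f(λ')} d_λ(N)`. -/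
def phiGF (N l : ℕ) (t β : ℝ) : ℝ :=
  (1 - t ^ 2) ^ (N * (N - 1) / 2) * (1 - β * t) ^ N *
    ∑' μ : {μ : YoungDiagram // numRows μ ≤ l},
      t ^ (μ.1.card) * β ^ (oddCols μ.1) * (dCount N μ.1 : ℝ)

/-- `η(t) = 2t/(1+t)`. -/
def etaT (t : ℝ) : ℝ := 2 * t / (1 + t)

/-- `ρ(t) = (t(1-t))^{1/3}/(1+t)`. -/
def rhoT (t : ℝ) : ℝ := (t * (1 - t)) ^ ((1 : ℝ) / 3) / (1 + t)

open scoped ENNReal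

namespace YoungDiagram

/-- The diagram `ν` is obtained from `μ` by removing a horizontal strip. -/
def HStrip (ν μ : YoungDiagram) : Prop :=
  ∀ i, μ.rowLen (i + 1) ≤ ν.rowLen i ∧ ν.rowLen i ≤ μ.rowLen i

/-- The diagram `ν` is obtained from `μ` by removing a vertical strip. -/
def VStrip (ν μ : YoungDiagram) : Prop :=
  ∀ i, ν.rowLen i ≤ μ.rowLen i ∧ μ.rowLen i ≤ ν.rowLen i + 1

theorem ext_rowLen {μ ν : YoungDiagram} (h : ∀ i, μ.rowLen i = ν.rowLen i) : μ = ν := by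
  ext ⟨i, j⟩
  rw [mem_cells, mem_cells, mem_iff_lt_rowLen, mem_iff_lt_rowLen, h]

theorem le_iff_rowLen {μ ν : YoungDiagram} : μ ≤ ν ↔ ∀ i, μ.rowLen i ≤ ν.rowLen i := by
  constructor
  · intro h i
    by_contra! hlt
    have h1 : (i, ν.rowLen i) ∈ ν := h (mem_iff_lt_rowLen.2 hlt)
    exact lt_irrefl _ (mem_iff_lt_rowLen.1 h1)
  · rintro h ⟨i, j⟩ hij
    exact mem_iff_lt_rowLen.2 ((mem_iff_lt_rowLen.1 hij).trans_le (h i))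

theorem HStrip.le {ν μ : YoungDiagram} (h : HStrip ν μ) : ν ≤ μ :=
  le_iff_rowLen.2 fun i => (h i).2

theorem VStrip.le {ν μ : YoungDiagram} (h : VStrip ν μ) : ν ≤ μ :=
  le_iff_rowLen.2 fun i => (h i).1

theorem card_le_of_le {ν μ : YoungDiagram} (h : ν ≤ μ) : ν.card ≤ μ.card :=
  Finset.card_le_card (cells_subset_iff.2 h)

theorem hStrip_iff_mem {ν μ : YoungDiagram} :
    HStrip ν μ ↔ ν ≤ μ ∧ ∀ i j, (i + 1, j) ∈ μ → (i, j) ∈ ν := by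
  constructor
  · refine fun h => ⟨h.le, fun i j hij => ?_⟩
    exact mem_iff_lt_rowLen.2 ((mem_iff_lt_rowLen.1 hij).trans_le (h i).1)
  · rintro ⟨h1, h2⟩ i
    refine ⟨?_, le_iff_rowLen.1 h1 i⟩
    by_contra! hlt
    exact lt_irrefl _ (mem_iff_lt_rowLen.1 (h2 _ _ (mem_iff_lt_rowLen.2 hlt)))

theorem vStrip_iff_mem {ν μ : YoungDiagram} :
    VStrip ν μ ↔ ν ≤ μ ∧ ∀ i j, (i, j + 1) ∈ μ → (i, j) ∈ ν := by
  constructor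
  · refine fun h => ⟨h.le, fun i j hij => ?_⟩
    have h1 := mem_iff_lt_rowLen.1 hij
    have h2 := (h i).2
    exact mem_iff_lt_rowLen.2 (by omega)
  · rintro ⟨h1, h2⟩ i
    refine ⟨le_iff_rowLen.1 h1 i, ?_⟩
    by_contra! hlt
    exact lt_irrefl _ (mem_iff_lt_rowLen.1 (h2 _ _ (mem_iff_lt_rowLen.2 hlt)))

theorem vStrip_iff_hStrip_transpose {ν μ : YoungDiagram} :
    VStrip ν μ ↔ HStrip ν.transpose μ.transpose := by
  rw [vStrip_iff_mem, hStrip_iff_mem, transpose_le_iff]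
  simp only [mem_transpose, Prod.swap_prod_mk]
  exact and_congr_right fun _ => forall_comm

theorem rowLen_eq_zero_of_le {μ : YoungDiagram} {m n : ℕ} (h : μ.rowLen m = 0) (hmn : m ≤ n) :
    μ.rowLen n = 0 :=
  Nat.le_zero.1 (h ▸ μ.rowLen_anti m n hmn)

theorem rowLen_eq_zero_iff {μ : YoungDiagram} {n : ℕ} : μ.rowLen n = 0 ↔ μ.colLen 0 ≤ n := by
  have h1 := mem_iff_lt_rowLen (μ := μ) (i := n) (j := 0)
  have h2 := mem_iff_lt_colLen (μ := μ) (i := n) (j := 0)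
  have h3 := h1.symm.trans h2
  omega

theorem colLen_eq_zero_iff {μ : YoungDiagram} {n : ℕ} : μ.colLen n = 0 ↔ μ.rowLen 0 ≤ n := by
  rw [← rowLen_transpose, rowLen_eq_zero_iff, colLen_transpose]

theorem prod_cells_eq_prod_rows {M : Type*} [CommMonoid M] {μ : YoungDiagram} {n : ℕ}
    (hn : μ.rowLen n = 0) (g : ℕ × ℕ → M) :
    ∏ c ∈ μ.cells, g c = ∏ i ∈ Finset.range n, ∏ j ∈ Finset.range (μ.rowLen i), g (i, j) := by
  refine Finset.prod_finset_product _ _ _ ?_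
  rintro ⟨i, j⟩
  simp only [mem_cells, mem_iff_lt_rowLen, Finset.mem_range]
  refine ⟨fun h => ⟨?_, h⟩, fun h => h.2⟩
  by_contra! hni
  rw [rowLen_eq_zero_of_le hn hni] at h
  omega

theorem prod_cells_eq_prod_cols {M : Type*} [CommMonoid M] {μ : YoungDiagram} {n : ℕ}
    (hn : μ.colLen n = 0) (g : ℕ × ℕ → M) :
    ∏ c ∈ μ.cells, g c = ∏ j ∈ Finset.range n, ∏ i ∈ Finset.range (μ.colLen j), g (i, j) := by
  refine Finset.prod_finset_product_right _ _ _ ?_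
  rintro ⟨i, j⟩
  simp only [mem_cells, mem_iff_lt_colLen, Finset.mem_range]
  refine ⟨fun h => ⟨?_, h⟩, fun h => h.2⟩
  by_contra! hni
  have := μ.colLen_anti n j hni
  omega

theorem card_eq_sum_rowLen {μ : YoungDiagram} {n : ℕ} (hn : μ.rowLen n = 0) :
    μ.card = ∑ i ∈ Finset.range n, μ.rowLen i := by
  have h := prod_cells_eq_prod_rows hn (fun _ => Multiplicative.ofAdd 1)
  simp only [Finset.prod_const, Finset.card_range, Finset.prod_pow_eq_pow_sum] at h
  have := congrArg Multiplicative.toAdd h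
  simpa using this

theorem card_transpose (μ : YoungDiagram) : μ.transpose.card = μ.card := by
  simp [YoungDiagram.card, transpose]

/-- The diagram with prescribed row lengths. -/
theorem exists_rowLen_eq {n : ℕ} (f : ℕ → ℕ) (hf : Antitone f) (hn : f n = 0) :
    ∃ μ : YoungDiagram, ∀ i, μ.rowLen i = f i := by
  have hmem : ∀ c : ℕ × ℕ,
      c ∈ (Finset.range n ×ˢ Finset.range (f 0)).filter (fun c => c.2 < f c.1) ↔ c.2 < f c.1 := by
    rintro ⟨i, j⟩
    simp only [Finset.mem_filter, Finset.mem_product, Finset.mem_range, and_iff_right_iff_imp]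
    intro h
    refine ⟨?_, h.trans_le (hf (Nat.zero_le i))⟩
    by_contra! hni
    have := hf hni
    omega
  have hlow : IsLowerSet (((Finset.range n ×ˢ Finset.range (f 0)).filter
      (fun c => c.2 < f c.1) : Finset (ℕ × ℕ)) : Set (ℕ × ℕ)) := by
    rintro ⟨i, j⟩ ⟨i', j'⟩ ⟨h1, h2⟩ h
    simp only [SetLike.mem_coe, hmem] at h ⊢
    simp only at h1 h2
    exact (h2.trans_lt h).trans_le (hf h1)
  refine ⟨⟨_, hlow⟩, fun i => ?_⟩
  have h : ∀ j, j < rowLen ⟨_, hlow⟩ i ↔ j < f i := fun j =>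
    (mem_iff_lt_rowLen (μ := ⟨_, hlow⟩) (i := i) (j := j)).symm.trans (hmem (i, j))
  have h1 := h (f i)
  have h2 := h (rowLen ⟨_, hlow⟩ i)
  omega

theorem _root_.ENNReal.tsum_pi_prod (n : ℕ) (g : ℕ → ℕ → ℝ≥0∞) :
    ∑' f : Fin n → ℕ, ∏ i : Fin n, g i (f i) = ∏ i ∈ Finset.range n, ∑' a, g i a := by
  induction n generalizing g with
  | zero => simp
  | succ n ih =>
    rw [← (Fin.consEquiv fun _ : Fin (n + 1) => ℕ).tsum_eq, ENNReal.tsum_prod']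
    simp only [Fin.consEquiv_apply, Fin.prod_univ_succ, Fin.cons_zero, Fin.cons_succ,
      Fin.val_zero, Fin.val_succ]
    simp_rw [ENNReal.tsum_mul_left]
    rw [ENNReal.tsum_mul_right, ih (fun i => g (i + 1)), Finset.prod_range_succ', mul_comm]

/-- A sum over Young diagrams of a product of row weights factorizes when the supports of the
row weights are decreasing. -/
theorem tsum_prod_rowLen (n : ℕ) (g : ℕ → ℕ → ℝ≥0∞)
    (hg : ∀ i a b, g i a ≠ 0 → g (i + 1) b ≠ 0 → b ≤ a) :
    ∑' μ : YoungDiagram,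
        (if μ.rowLen n = 0 then ∏ i ∈ Finset.range n, g i (μ.rowLen i) else 0) =
      ∏ i ∈ Finset.range n, ∑' a, g i a := by
  rw [← ENNReal.tsum_pi_prod]
  have h1 := tsum_subtype {μ : YoungDiagram | μ.rowLen n = 0}
    (fun μ => ∏ i ∈ Finset.range n, g i (μ.rowLen i))
  simp only [Set.indicator_apply, Set.mem_ofPred_eq] at h1
  rw [← h1]
  let e : {μ : YoungDiagram | μ.rowLen n = 0} → (Fin n → ℕ) := fun μ i => μ.1.rowLen i
  have he : Function.Injective e := by
    rintro ⟨μ, hμ⟩ ⟨ν, hν⟩ h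
    refine Subtype.ext (ext_rowLen fun i => ?_)
    rcases lt_or_ge i n with hi | hi
    · exact congrFun h ⟨i, hi⟩
    · rw [rowLen_eq_zero_of_le hμ hi, rowLen_eq_zero_of_le hν hi]
  have hsupp : Function.support (fun f : Fin n → ℕ => ∏ i : Fin n, g i (f i)) ⊆ Set.range e := by
    intro f hf
    have hf' : ∀ i : Fin n, g i (f i) ≠ 0 := fun i hi =>
      hf (Finset.prod_eq_zero (Finset.mem_univ i) hi)
    obtain ⟨μ, hμ⟩ := exists_rowLen_eq (n := n) (fun i => if h : i < n then f ⟨i, h⟩ else 0)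
      (antitone_nat_of_succ_le fun i => by
        by_cases h : i + 1 < n
        · have h' : i < n := by omega
          simp only [h, h', dif_pos]
          exact hg i _ _ (hf' ⟨i, h'⟩) (hf' ⟨i + 1, h⟩)
        · simp [h]) (by simp)
    refine ⟨⟨μ, by simp [hμ]⟩, ?_⟩
    funext i
    simp [e, hμ]
  rw [← he.tsum_eq hsupp]
  exact tsum_congr fun μ => (Fin.prod_univ_eq_prod_range (fun i => g i (μ.1.rowLen i)) n).symm

theorem tsum_prod_colLen (n : ℕ) (g : ℕ → ℕ → ℝ≥0∞)
    (hg : ∀ i a b, g i a ≠ 0 → g (i + 1) b ≠ 0 → b ≤ a) :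
    ∑' μ : YoungDiagram,
        (if μ.colLen n = 0 then ∏ i ∈ Finset.range n, g i (μ.colLen i) else 0) =
      ∏ i ∈ Finset.range n, ∑' a, g i a := by
  rw [← tsum_prod_rowLen n g hg, ← transposeOrderIso.toEquiv.tsum_eq]
  simp [transposeOrderIso]

/-- The weight `x ^ |μ / ν|` of a horizontal strip, and zero for other pairs of diagrams. -/
def hWeight (x : ℝ≥0∞) (ν μ : YoungDiagram) : ℝ≥0∞ :=
  if HStrip ν μ then x ^ (μ.card - ν.card) else 0

/-- The weight `x ^ |μ / ν|` of a vertical strip, and zero for other pairs of diagrams. -/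
def vWeight (x : ℝ≥0∞) (ν μ : YoungDiagram) : ℝ≥0∞ :=
  if VStrip ν μ then x ^ (μ.card - ν.card) else 0

theorem pow_card_sub_eq_prod {ν μ : YoungDiagram} (h : ν ≤ μ) {n : ℕ} (hn : μ.rowLen n = 0)
    (x : ℝ≥0∞) :
    x ^ (μ.card - ν.card) = ∏ i ∈ Finset.range n, x ^ (μ.rowLen i - ν.rowLen i) := by
  have h1 := le_iff_rowLen.1 h
  have hn' : ν.rowLen n = 0 := Nat.le_zero.1 (hn ▸ h1 n)
  rw [Finset.prod_pow_eq_pow_sum, Finset.sum_tsub_distrib _ fun i _ => h1 i,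
    card_eq_sum_rowLen hn, card_eq_sum_rowLen hn']

theorem hWeight_eq_prod_of_lower {ν : YoungDiagram} {n : ℕ} (hn : ν.rowLen n = 0) (x : ℝ≥0∞)
    (μ : YoungDiagram) :
    hWeight x ν μ = if μ.rowLen (n + 1) = 0 then ∏ i ∈ Finset.range (n + 1),
      (if ν.rowLen i ≤ μ.rowLen i ∧ ∀ k, k + 1 = i → μ.rowLen i ≤ ν.rowLen k
        then x ^ (μ.rowLen i - ν.rowLen i) else 0) else 0 := by
  have key : HStrip ν μ ↔ μ.rowLen (n + 1) = 0 ∧ ∀ i ∈ Finset.range (n + 1),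
      ν.rowLen i ≤ μ.rowLen i ∧ ∀ k, k + 1 = i → μ.rowLen i ≤ ν.rowLen k := by
    constructor
    · refine fun h => ⟨Nat.le_zero.1 (hn ▸ (h n).1), fun i _ => ⟨(h i).2, ?_⟩⟩
      rintro k rfl
      exact (h k).1
    · rintro ⟨h0, h⟩ i
      rcases lt_or_ge i n with hi | hi
      · exact ⟨(h (i + 1) (by simpa using hi)).2 i rfl, (h i (by simp; omega)).1⟩
      · rw [rowLen_eq_zero_of_le h0 (by omega : n + 1 ≤ i + 1), rowLen_eq_zero_of_le hn hi]
        simp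
  rw [Finset.prod_ite_zero, ← ite_and, hWeight]
  by_cases h : HStrip ν μ
  · rw [if_pos h, if_pos (key.1 h), pow_card_sub_eq_prod h.le (key.1 h).1]
  · rw [if_neg h, if_neg fun h' => h (key.2 h')]

theorem hWeight_eq_prod_of_upper {μ : YoungDiagram} {n : ℕ} (hn : μ.rowLen n = 0) (x : ℝ≥0∞)
    (ν : YoungDiagram) :
    hWeight x ν μ = if ν.rowLen n = 0 then ∏ i ∈ Finset.range n,
      (if μ.rowLen (i + 1) ≤ ν.rowLen i ∧ ν.rowLen i ≤ μ.rowLen i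
        then x ^ (μ.rowLen i - ν.rowLen i) else 0) else 0 := by
  have key : HStrip ν μ ↔ ν.rowLen n = 0 ∧ ∀ i ∈ Finset.range n,
      μ.rowLen (i + 1) ≤ ν.rowLen i ∧ ν.rowLen i ≤ μ.rowLen i := by
    constructor
    · exact fun h => ⟨Nat.le_zero.1 (hn ▸ (h n).2), fun i _ => h i⟩
    · rintro ⟨h0, h⟩ i
      rcases lt_or_ge i n with hi | hi
      · exact h i (by simpa using hi)
      · rw [rowLen_eq_zero_of_le h0 hi, rowLen_eq_zero_of_le hn hi,
          rowLen_eq_zero_of_le hn (by omega : n ≤ i + 1)]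
        simp
  rw [Finset.prod_ite_zero, ← ite_and, hWeight]
  by_cases h : HStrip ν μ
  · rw [if_pos h, if_pos (key.1 h), pow_card_sub_eq_prod h.le hn]
  · rw [if_neg h, if_neg fun h' => h (key.2 h')]

theorem vWeight_eq_prod {ν μ : YoungDiagram} {n : ℕ} (hν : ν.rowLen n = 0) (hμ : μ.rowLen n = 0)
    (x : ℝ≥0∞) :
    vWeight x ν μ = ∏ i ∈ Finset.range n,
      (if ν.rowLen i ≤ μ.rowLen i ∧ μ.rowLen i ≤ ν.rowLen i + 1
        then x ^ (μ.rowLen i - ν.rowLen i) else 0) := by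
  have key : VStrip ν μ ↔ ∀ i ∈ Finset.range n,
      ν.rowLen i ≤ μ.rowLen i ∧ μ.rowLen i ≤ ν.rowLen i + 1 := by
    refine ⟨fun h i _ => h i, fun h i => ?_⟩
    rcases lt_or_ge i n with hi | hi
    · exact h i (by simpa using hi)
    · rw [rowLen_eq_zero_of_le hν hi, rowLen_eq_zero_of_le hμ hi]
      simp
  rw [Finset.prod_ite_zero, vWeight]
  by_cases h : VStrip ν μ
  · rw [if_pos h, if_pos (key.1 h), pow_card_sub_eq_prod h.le hμ]
  · rw [if_neg h, if_neg fun h' => h (key.2 h')]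

theorem exists_rowLen_eq_zero (μ ν : YoungDiagram) : ∃ n, μ.rowLen n = 0 ∧ ν.rowLen n = 0 :=
  ⟨max (μ.colLen 0) (ν.colLen 0), rowLen_eq_zero_iff.2 (le_max_left _ _),
    rowLen_eq_zero_iff.2 (le_max_right _ _)⟩

theorem _root_.ENNReal.tsum_ite_ge (m : ℕ) (F : ℕ → ℝ≥0∞) :
    ∑' a, (if m ≤ a then F a else 0) = ∑' k, F (m + k) := by
  rw [← (add_right_injective m).tsum_eq]
  · simp
  · intro a ha
    have h : m ≤ a := by
      by_contra h
      simp [h] at ha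
    exact ⟨a - m, by simp; omega⟩

theorem _root_.ENNReal.tsum_ite_Icc (m M : ℕ) (F : ℕ → ℝ≥0∞) :
    ∑' a, (if m ≤ a ∧ a ≤ M then F a else 0) = ∑ a ∈ Finset.Icc m M, F a := by
  rw [tsum_eq_sum (s := Finset.Icc m M) fun a ha => by
    rw [if_neg]; simpa using ha]
  exact Finset.sum_congr rfl fun a ha => by rw [if_pos (by simpa using ha)]

theorem _root_.Finset.sum_Icc_reflect_add {M : Type*} [AddCommMonoid M] (a b : ℕ) (F : ℕ → M) :
    ∑ k ∈ Finset.Icc a b, F k = ∑ k ∈ Finset.Icc a b, F (a + b - k) := by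
  refine Finset.sum_nbij' (fun k => a + b - k) (fun k => a + b - k) ?_ ?_ ?_ ?_ ?_ <;>
    simp only [Finset.mem_Icc] <;> intro k hk
  · omega
  · omega
  · omega
  · omega
  · congr 1
    omega

theorem tsum_hWeight_mul_hWeight (z x : ℝ≥0∞) (ν μ : YoungDiagram) :
    ∑' κ, hWeight z ν κ * hWeight x μ κ =
      (1 - z * x)⁻¹ * ∑' κ, hWeight x κ ν * hWeight z κ μ := by
  obtain ⟨n, hμ, hν⟩ := exists_rowLen_eq_zero μ ν
  simp_rw [hWeight_eq_prod_of_lower hν, hWeight_eq_prod_of_lower hμ,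
    hWeight_eq_prod_of_upper hν, hWeight_eq_prod_of_upper hμ, ite_zero_mul_ite_zero, and_self,
    ← Finset.prod_mul_distrib]
  rw [tsum_prod_rowLen (n + 1) (fun i a =>
    (if ν.rowLen i ≤ a ∧ ∀ k, k + 1 = i → a ≤ ν.rowLen k then z ^ (a - ν.rowLen i) else 0) *
    (if μ.rowLen i ≤ a ∧ ∀ k, k + 1 = i → a ≤ μ.rowLen k then x ^ (a - μ.rowLen i) else 0)),
    tsum_prod_rowLen n (fun i a =>
    (if ν.rowLen (i + 1) ≤ a ∧ a ≤ ν.rowLen i then x ^ (ν.rowLen i - a) else 0) *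
    (if μ.rowLen (i + 1) ≤ a ∧ a ≤ μ.rowLen i then z ^ (μ.rowLen i - a) else 0))]
  · let m : ℕ → ℝ≥0∞ := fun i => z ^ (max (μ.rowLen i) (ν.rowLen i) - ν.rowLen i) *
      x ^ (max (μ.rowLen i) (ν.rowLen i) - μ.rowLen i)
    let C : ℕ → ℝ≥0∞ := fun i => ∑ a ∈ Finset.Icc (max (μ.rowLen (i + 1)) (ν.rowLen (i + 1)))
      (min (μ.rowLen i) (ν.rowLen i)),
      (z * x) ^ (a - max (μ.rowLen (i + 1)) (ν.rowLen (i + 1)))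
    have hA0 : ∑' a, (if ν.rowLen 0 ≤ a ∧ ∀ k, k + 1 = 0 → a ≤ ν.rowLen k
          then z ^ (a - ν.rowLen 0) else 0) *
        (if μ.rowLen 0 ≤ a ∧ ∀ k, k + 1 = 0 → a ≤ μ.rowLen k
          then x ^ (a - μ.rowLen 0) else 0) = m 0 * (1 - z * x)⁻¹ := by
      rw [← ENNReal.tsum_geometric, ← ENNReal.tsum_mul_left]
      have := ENNReal.tsum_ite_ge (max (μ.rowLen 0) (ν.rowLen 0)) fun a =>
        z ^ (a - ν.rowLen 0) * x ^ (a - μ.rowLen 0)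
      convert this using 3 with a k
      · rw [ite_zero_mul_ite_zero]
        simp [and_comm]
      · simp only [m]
        rw [mul_pow, mul_mul_mul_comm, ← pow_add, ← pow_add]
        congr 2 <;> omega
    have hA : ∀ i, ∑' a, (if ν.rowLen (i + 1) ≤ a ∧ ∀ k, k + 1 = i + 1 → a ≤ ν.rowLen k
          then z ^ (a - ν.rowLen (i + 1)) else 0) *
        (if μ.rowLen (i + 1) ≤ a ∧ ∀ k, k + 1 = i + 1 → a ≤ μ.rowLen k
          then x ^ (a - μ.rowLen (i + 1)) else 0) = m (i + 1) * C i := by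
      intro i
      simp only [C]
      rw [Finset.mul_sum, ← ENNReal.tsum_ite_Icc]
      refine tsum_congr fun a => ?_
      rw [ite_zero_mul_ite_zero]
      refine ite_congr ?_ (fun h => ?_) fun _ => rfl
      · simp only [Nat.add_right_cancel_iff, forall_eq, max_le_iff, le_min_iff, eq_iff_iff]
        tauto
      · simp only [m]
        rw [mul_pow, mul_mul_mul_comm, ← pow_add, ← pow_add]
        congr 2 <;> omega
    have hB : ∀ i, ∑' a, (if ν.rowLen (i + 1) ≤ a ∧ a ≤ ν.rowLen i
          then x ^ (ν.rowLen i - a) else 0) *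
        (if μ.rowLen (i + 1) ≤ a ∧ a ≤ μ.rowLen i then z ^ (μ.rowLen i - a) else 0) =
          m i * C i := by
      intro i
      simp only [C]
      rw [Finset.sum_Icc_reflect_add, Finset.mul_sum, ← ENNReal.tsum_ite_Icc]
      refine tsum_congr fun a => ?_
      rw [ite_zero_mul_ite_zero]
      refine ite_congr ?_ (fun h => ?_) fun _ => rfl
      · simp only [max_le_iff, le_min_iff, eq_iff_iff]
        tauto
      · simp only [m]
        rw [mul_pow, mul_mul_mul_comm, ← pow_add, ← pow_add, mul_comm]
        congr 2 <;> omega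
    have hm : m n = 1 := by simp [m, hμ, hν]
    rw [Finset.prod_range_succ', hA0, Finset.prod_congr rfl fun i _ => hA i,
      Finset.prod_congr rfl fun i _ => hB i,
      Finset.prod_mul_distrib (f := fun i => m (i + 1)), Finset.prod_mul_distrib (f := m)]
    have h1 := (Finset.prod_range_succ m n).symm.trans (Finset.prod_range_succ' m n)
    rw [hm, mul_one] at h1
    rw [h1]
    ring
  · intro i a b h1 h2
    simp only [ne_eq, mul_eq_zero, ite_eq_right_iff, not_or, Classical.not_imp] at h1 h2
    exact h2.1.1.2.trans h1.1.1.1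
  · intro i a b h1 h2
    simp only [ne_eq, mul_eq_zero, ite_eq_right_iff, not_or, Classical.not_imp] at h1 h2
    exact (h2.1.1.2 i rfl).trans h1.1.1.1

theorem prod_range_alternating {M : Type*} [CommMonoid M] {b : ℕ → M}
    (h : ∀ i, b i * b (i + 1) = 1) (m : ℕ) :
    ∏ i ∈ Finset.range m, b i = if Odd m then b 0 else 1 := by
  have hb : ∀ i, b (2 * i) = b 0 := by
    intro i
    induction i with
    | zero => rfl
    | succ i ih =>
      have h1 := h (2 * i)
      have h2 := h (2 * i + 1)
      calc b (2 * i + 1 + 1) = b (2 * i) * b (2 * i + 1) * b (2 * i + 1 + 1) := by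
            rw [h1, one_mul]
        _ = b (2 * i) * (b (2 * i + 1) * b (2 * i + 1 + 1)) := mul_assoc _ _ _
        _ = b 0 := by rw [h2, mul_one, ih]
  have heven : ∀ i, ∏ k ∈ Finset.range (2 * i), b k = 1 := by
    intro i
    induction i with
    | zero => simp
    | succ i ih =>
      rw [Nat.mul_succ, Finset.prod_range_succ, Finset.prod_range_succ, ih, one_mul, h]
  rcases Nat.even_or_odd' m with ⟨i, rfl | rfl⟩
  · rw [heven, if_neg (by simp)]
  · rw [Finset.prod_range_succ, heven, one_mul, hb, if_pos (by simp)]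

theorem rowLen_le_card (μ : YoungDiagram) (i : ℕ) : μ.rowLen i ≤ μ.card := by
  rw [rowLen_eq_card]
  exact Finset.card_le_card (Finset.filter_subset _ _)

theorem pow_oddCols_eq_prod_cols {M : Type*} [CommMonoid M] {μ : YoungDiagram} {n : ℕ}
    (hn : μ.colLen n = 0) (β : M) :
    β ^ oddCols μ = ∏ j ∈ Finset.range n, if Odd (μ.colLen j) then β else 1 := by
  have hcard : μ.colLen μ.card = 0 := colLen_eq_zero_iff.2 (μ.rowLen_le_card 0)
  have key : ∀ m k, m ≤ k → μ.colLen m = 0 →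
      ∏ j ∈ Finset.range m, (if Odd (μ.colLen j) then β else 1) =
        ∏ j ∈ Finset.range k, (if Odd (μ.colLen j) then β else 1) := by
    intro m k hmk hm
    refine Finset.prod_subset (Finset.range_mono hmk) fun j _ hj => ?_
    have h := μ.colLen_anti m j (by simpa using hj)
    have h0 : μ.colLen j = 0 := by omega
    simp [h0]
  have h : β ^ oddCols μ =
      ∏ j ∈ Finset.range μ.card, if Odd (μ.colLen j) then β else 1 := by
    rw [oddCols, ← Finset.prod_filter, Finset.prod_const]
  rw [h]
  rcases le_total μ.card n with h | h
  · exact key _ _ h hcard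
  · exact (key _ _ h hn).symm

theorem pow_oddCols_eq_prod_rows {M : Type*} [CommMonoid M] {μ : YoungDiagram} {n : ℕ}
    (hn : μ.rowLen n = 0) {b : ℕ → M} (h : ∀ i, b i * b (i + 1) = 1) :
    b 0 ^ oddCols μ = ∏ i ∈ Finset.range n, b i ^ μ.rowLen i := by
  have h1 := prod_cells_eq_prod_rows hn fun c => b c.1
  rw [prod_cells_eq_prod_cols (colLen_eq_zero_iff.2 le_rfl)] at h1
  simp only [prod_range_alternating h, Finset.prod_const, Finset.card_range] at h1
  rw [← h1, pow_oddCols_eq_prod_cols (colLen_eq_zero_iff.2 le_rfl)]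

/-- Summing `β ^ oddCols` over horizontal strips above or below a given diagram gives the same
result up to a constant factor. -/
theorem tsum_hWeight_mul_pow_oddCols (x : ℝ≥0∞) {β : ℝ≥0∞} (hβ : β ≠ 0) (hβ' : β ≠ ∞)
    (μ : YoungDiagram) :
    ∑' κ, hWeight x μ κ * β ^ oddCols κ =
      (1 - β * x)⁻¹ * ∑' κ, hWeight x κ μ * β ^ oddCols κ := by
  obtain ⟨n, hμ, -⟩ := exists_rowLen_eq_zero μ μ
  obtain ⟨b, hb0, hb⟩ : ∃ b : ℕ → ℝ≥0∞, b 0 = β ∧ ∀ i, b i * b (i + 1) = 1 := by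
    refine ⟨fun i => if Even i then β else β⁻¹, by simp, fun i => ?_⟩
    have h1 := ENNReal.mul_inv_cancel hβ hβ'
    by_cases h : Even i
    · simpa [h, Nat.even_add_one] using h1
    · simpa [h, Nat.even_add_one, mul_comm] using h1
  have hL : ∀ κ, hWeight x μ κ * β ^ oddCols κ = if κ.rowLen (n + 1) = 0 then
      ∏ i ∈ Finset.range (n + 1),
        (if μ.rowLen i ≤ κ.rowLen i ∧ ∀ k, k + 1 = i → κ.rowLen i ≤ μ.rowLen k
          then x ^ (κ.rowLen i - μ.rowLen i) else 0) * b i ^ κ.rowLen i else 0 := by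
    intro κ
    rw [hWeight_eq_prod_of_lower hμ, ite_mul, zero_mul]
    refine ite_congr rfl (fun h => ?_) fun _ => rfl
    rw [← hb0, pow_oddCols_eq_prod_rows h hb, Finset.prod_mul_distrib]
  have hR : ∀ κ, hWeight x κ μ * β ^ oddCols κ = if κ.rowLen n = 0 then
      ∏ i ∈ Finset.range n, (if μ.rowLen (i + 1) ≤ κ.rowLen i ∧ κ.rowLen i ≤ μ.rowLen i
          then x ^ (μ.rowLen i - κ.rowLen i) else 0) * b i ^ κ.rowLen i else 0 := by
    intro κ
    rw [hWeight_eq_prod_of_upper hμ, ite_mul, zero_mul]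
    refine ite_congr rfl (fun h => ?_) fun _ => rfl
    rw [← hb0, pow_oddCols_eq_prod_rows h hb, Finset.prod_mul_distrib]
  simp_rw [hL, hR]
  rw [tsum_prod_rowLen (n + 1) (fun i a =>
    (if μ.rowLen i ≤ a ∧ ∀ k, k + 1 = i → a ≤ μ.rowLen k then x ^ (a - μ.rowLen i) else 0) *
      b i ^ a),
    tsum_prod_rowLen n (fun i a =>
    (if μ.rowLen (i + 1) ≤ a ∧ a ≤ μ.rowLen i then x ^ (μ.rowLen i - a) else 0) * b i ^ a)]
  · let m : ℕ → ℝ≥0∞ := fun i => b i ^ μ.rowLen i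
    let m' : ℕ → ℝ≥0∞ := fun i => b (i + 1) ^ μ.rowLen i
    let B : ℕ → ℝ≥0∞ := fun i => ∑ a ∈ Finset.Icc (μ.rowLen (i + 1)) (μ.rowLen i),
      x ^ (μ.rowLen i - a) * b i ^ a
    have hmm : ∀ i, m i * m' i = 1 := fun i => by simp only [m, m']; rw [← mul_pow, hb, one_pow]
    have hA0 : ∑' a, (if μ.rowLen 0 ≤ a ∧ ∀ k, k + 1 = 0 → a ≤ μ.rowLen k
          then x ^ (a - μ.rowLen 0) else 0) * b 0 ^ a = m 0 * (1 - β * x)⁻¹ := by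
      rw [← ENNReal.tsum_geometric, ← ENNReal.tsum_mul_left]
      have := ENNReal.tsum_ite_ge (μ.rowLen 0) fun a => x ^ (a - μ.rowLen 0) * b 0 ^ a
      convert this using 3 with a k
      · simp
      · simp only [m, hb0, Nat.add_sub_cancel_left]
        ring
    have hA : ∀ i, ∑' a, (if μ.rowLen (i + 1) ≤ a ∧ ∀ k, k + 1 = i + 1 → a ≤ μ.rowLen k
          then x ^ (a - μ.rowLen (i + 1)) else 0) * b (i + 1) ^ a = m (i + 1) * (m' i * B i) := by
      intro i
      simp only [B]
      rw [Finset.sum_Icc_reflect_add, Finset.mul_sum, Finset.mul_sum, ← ENNReal.tsum_ite_Icc]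
      refine tsum_congr fun a => ?_
      rw [ite_mul, zero_mul]
      refine ite_congr (by simp) (fun h => ?_) fun _ => rfl
      have h1 : μ.rowLen i - (μ.rowLen (i + 1) + μ.rowLen i - a) = a - μ.rowLen (i + 1) := by omega
      have h2 : b (i + 1) ^ a =
          b (i + 1) ^ (a + (μ.rowLen (i + 1) + μ.rowLen i - a)) *
            b i ^ (μ.rowLen (i + 1) + μ.rowLen i - a) := by
        rw [pow_add, mul_assoc, ← mul_pow, mul_comm (b (i + 1)) (b i), hb, one_pow, mul_one]
      rw [h1, h2, (by omega : a + (μ.rowLen (i + 1) + μ.rowLen i - a) =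
        μ.rowLen (i + 1) + μ.rowLen i), pow_add]
      simp only [m, m']
      ring
    have hB : ∀ i, ∑' a, (if μ.rowLen (i + 1) ≤ a ∧ a ≤ μ.rowLen i
          then x ^ (μ.rowLen i - a) else 0) * b i ^ a = B i := by
      intro i
      simp only [B]
      rw [← ENNReal.tsum_ite_Icc]
      exact tsum_congr fun a => by rw [ite_mul, zero_mul]
    have hm : m n = 1 := by simp [m, hμ]
    rw [Finset.prod_range_succ', hA0, Finset.prod_congr rfl fun i _ => hA i,
      Finset.prod_congr rfl fun i _ => hB i,
      Finset.prod_mul_distrib (f := fun i => m (i + 1)), Finset.prod_mul_distrib (f := m')]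
    have h1 := (Finset.prod_range_succ m n).symm.trans (Finset.prod_range_succ' m n)
    have h2 : (∏ i ∈ Finset.range n, m i) * ∏ i ∈ Finset.range n, m' i = 1 := by
      rw [← Finset.prod_mul_distrib]
      exact Finset.prod_eq_one fun i _ => hmm i
    rw [hm, mul_one] at h1
    rw [h1] at h2
    calc _ = ((∏ k ∈ Finset.range n, m (k + 1)) * m 0 * ∏ i ∈ Finset.range n, m' i) *
          ((1 - β * x)⁻¹ * ∏ i ∈ Finset.range n, B i) := by ring
      _ = _ := by rw [h2, one_mul]
  · intro i a c h1 h2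
    simp only [ne_eq, mul_eq_zero, ite_eq_right_iff, not_or, Classical.not_imp] at h1 h2
    exact h2.1.1.2.trans h1.1.1.1
  · intro i a c h1 h2
    simp only [ne_eq, mul_eq_zero, ite_eq_right_iff, not_or, Classical.not_imp] at h1 h2
    exact (h2.1.1.2 i rfl).trans h1.1.1.1

theorem tsum_vWeight_mul_hWeight (y x : ℝ≥0∞) (ν μ : YoungDiagram) :
    ∑' κ, vWeight y ν κ * hWeight x μ κ =
      (1 + x * y) * ∑' κ, hWeight x κ ν * vWeight y κ μ := by
  obtain ⟨n, hμ, hν⟩ := exists_rowLen_eq_zero μ ν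
  have hμ1 := rowLen_eq_zero_of_le hμ n.le_succ
  have hν1 := rowLen_eq_zero_of_le hν n.le_succ
  by_cases hc : ∀ i, μ.rowLen i ≤ ν.rowLen i + 1 ∧ ν.rowLen (i + 1) ≤ μ.rowLen i
  swap
  · have hL : ∀ κ, vWeight y ν κ * hWeight x μ κ = 0 := by
      intro κ
      rw [vWeight, hWeight, ite_zero_mul_ite_zero, if_neg]
      rintro ⟨h1, h2⟩
      exact hc fun i => ⟨(h2 i).2.trans (h1 i).2, (h1 (i + 1)).1.trans (h2 i).1⟩
    have hR : ∀ κ, hWeight x κ ν * vWeight y κ μ = 0 := by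
      intro κ
      rw [vWeight, hWeight, ite_zero_mul_ite_zero, if_neg]
      rintro ⟨h1, h2⟩
      exact hc fun i => ⟨(h2 i).2.trans (Nat.succ_le_succ (h1 i).2), (h1 i).1.trans (h2 i).1⟩
    simp [hL, hR]
  have hL : ∀ κ, vWeight y ν κ * hWeight x μ κ = if κ.rowLen (n + 1) = 0 then
      ∏ i ∈ Finset.range (n + 1),
        (if ν.rowLen i ≤ κ.rowLen i ∧ κ.rowLen i ≤ ν.rowLen i + 1
          then y ^ (κ.rowLen i - ν.rowLen i) else 0) *
        (if μ.rowLen i ≤ κ.rowLen i ∧ ∀ k, k + 1 = i → κ.rowLen i ≤ μ.rowLen k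
          then x ^ (κ.rowLen i - μ.rowLen i) else 0) else 0 := by
    intro κ
    rw [hWeight_eq_prod_of_lower hμ, mul_ite, mul_zero]
    refine ite_congr rfl (fun h => ?_) fun _ => rfl
    rw [vWeight_eq_prod hν1 h, Finset.prod_mul_distrib]
  have hR : ∀ κ, hWeight x κ ν * vWeight y κ μ = if κ.rowLen (n + 1) = 0 then
      ∏ i ∈ Finset.range (n + 1),
        (if ν.rowLen (i + 1) ≤ κ.rowLen i ∧ κ.rowLen i ≤ ν.rowLen i
          then x ^ (ν.rowLen i - κ.rowLen i) else 0) *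
        (if κ.rowLen i ≤ μ.rowLen i ∧ μ.rowLen i ≤ κ.rowLen i + 1
          then y ^ (μ.rowLen i - κ.rowLen i) else 0) else 0 := by
    intro κ
    rw [hWeight_eq_prod_of_upper hν1, ite_mul, zero_mul]
    refine ite_congr rfl (fun h => ?_) fun _ => rfl
    rw [vWeight_eq_prod h hμ1, Finset.prod_mul_distrib]
  simp_rw [hL, hR]
  let gL : ℕ → ℕ → ℝ≥0∞ := fun i a =>
    (if ν.rowLen i ≤ a ∧ a ≤ ν.rowLen i + 1 then y ^ (a - ν.rowLen i) else 0) *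
    (if μ.rowLen i ≤ a ∧ ∀ k, k + 1 = i → a ≤ μ.rowLen k then x ^ (a - μ.rowLen i) else 0)
  let gR : ℕ → ℕ → ℝ≥0∞ := fun i a =>
    (if ν.rowLen (i + 1) ≤ a ∧ a ≤ ν.rowLen i then x ^ (ν.rowLen i - a) else 0) *
    (if a ≤ μ.rowLen i ∧ μ.rowLen i ≤ a + 1 then y ^ (μ.rowLen i - a) else 0)
  rw [tsum_prod_rowLen (n + 1) gL, tsum_prod_rowLen (n + 1) gR]
  · let d : ℕ → ℝ≥0∞ := fun i =>
      if ∀ k, k + 1 = i → ν.rowLen (k + 1) < μ.rowLen k then 1 + x * y else 1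
    have hA : ∀ i, ∑' a, gL i a =
        (if μ.rowLen i ≤ ν.rowLen i then x ^ (ν.rowLen i - μ.rowLen i) else 0) +
        (if ∀ k, k + 1 = i → ν.rowLen (k + 1) < μ.rowLen k
          then y * x ^ (ν.rowLen i + 1 - μ.rowLen i) else 0) := by
      intro i
      rw [tsum_eq_sum (s := {ν.rowLen i, ν.rowLen i + 1}), Finset.sum_pair (by omega)]
      · have h1 := (hc i).1
        have h2 : (μ.rowLen i ≤ ν.rowLen i ∧ ∀ k, k + 1 = i → ν.rowLen i ≤ μ.rowLen k) ↔
            μ.rowLen i ≤ ν.rowLen i := by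
          refine and_iff_left ?_
          rintro k rfl
          exact (hc k).2
        have h3 : (μ.rowLen i ≤ ν.rowLen i + 1 ∧ ∀ k, k + 1 = i → ν.rowLen i + 1 ≤ μ.rowLen k) ↔
            ∀ k, k + 1 = i → ν.rowLen (k + 1) < μ.rowLen k := by
          rw [and_iff_right h1]
          refine forall_congr' fun k => ?_
          constructor <;> rintro h rfl <;> exact h rfl
        simp only [gL, h2, h3, le_refl, Nat.le_succ, and_self, if_true, Nat.sub_self, pow_zero,
          one_mul, Nat.add_sub_cancel_left, pow_one, mul_ite, mul_zero]
      · intro a ha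
        simp only [Finset.mem_insert, Finset.mem_singleton] at ha
        simp only [gL]
        rw [if_neg (by omega), zero_mul]
    have hB : ∀ i, ∑' a, gR i a =
        (if μ.rowLen i ≤ ν.rowLen i then x ^ (ν.rowLen i - μ.rowLen i) else 0) +
        (if ν.rowLen (i + 1) < μ.rowLen i
          then y * x ^ (ν.rowLen i + 1 - μ.rowLen i) else 0) := by
      intro i
      obtain ⟨h1, h2⟩ := hc i
      rcases Nat.eq_zero_or_pos (μ.rowLen i) with h0 | h0
      · rw [tsum_eq_single 0]
        · have h3 : ν.rowLen (i + 1) = 0 := by omega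
          simp [gR, h0, h3]
        · intro a ha
          simp only [gR]
          rw [if_neg (by omega : ¬(a ≤ μ.rowLen i ∧ μ.rowLen i ≤ a + 1)), mul_zero]
      · rw [tsum_eq_sum (s := {μ.rowLen i, μ.rowLen i - 1}), Finset.sum_pair (by omega)]
        · have h3 : ν.rowLen (i + 1) ≤ μ.rowLen i - 1 ↔ ν.rowLen (i + 1) < μ.rowLen i := by omega
          have h4 : μ.rowLen i ≤ μ.rowLen i - 1 + 1 := by omega
          have h5 : μ.rowLen i - (μ.rowLen i - 1) = 1 := by omega
          have h6 : ν.rowLen i - (μ.rowLen i - 1) = ν.rowLen i + 1 - μ.rowLen i := by omega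
          have h7 : μ.rowLen i - 1 ≤ ν.rowLen i := by omega
          simp [gR, h2, h3, h4, h5, h6, h7, mul_comm]
        · intro a ha
          simp only [Finset.mem_insert, Finset.mem_singleton] at ha
          simp only [gR]
          rw [if_neg (by omega : ¬(a ≤ μ.rowLen i ∧ μ.rowLen i ≤ a + 1)), mul_zero]
    have hAB : ∀ i, (∑' a, gL i a) * d (i + 1) = (∑' a, gR i a) * d i := by
      intro i
      rw [hA, hB]
      simp only [d, Nat.add_right_cancel_iff, forall_eq]
      by_cases hp : μ.rowLen i ≤ ν.rowLen i
      · rw [(by omega : ν.rowLen i + 1 - μ.rowLen i = ν.rowLen i - μ.rowLen i + 1), pow_succ]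
        split_ifs <;> ring
      · have h1 := (hc i).1
        have h2 : ν.rowLen (i + 1) < μ.rowLen i :=
          (ν.rowLen_anti i (i + 1) i.le_succ).trans_lt (not_le.1 hp)
        have h3 : ∀ k, k + 1 = i → ν.rowLen (k + 1) < μ.rowLen k := by
          rintro k rfl
          exact (not_le.1 hp).trans_le (μ.rowLen_anti k (k + 1) k.le_succ)
        rw [if_pos h2, if_pos h3, if_pos h2, if_pos h3]
    have hprod : ∀ k, (∏ i ∈ Finset.range k, ∑' a, gL i a) * d k =
        (∏ i ∈ Finset.range k, ∑' a, gR i a) * d 0 := by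
      intro k
      induction k with
      | zero => simp
      | succ k ih =>
        rw [Finset.prod_range_succ, Finset.prod_range_succ, mul_assoc, hAB, mul_left_comm,
          mul_right_comm, ← ih]
        ring
    have h := hprod (n + 1)
    have hd0 : d 0 = 1 + x * y := by simp [d]
    have hdn : d (n + 1) = 1 := by simp [d, hμ]
    rw [hdn, hd0, mul_one] at h
    rw [h, mul_comm]
  · intro i a c h1 h2
    simp only [gR, ne_eq, mul_eq_zero, ite_eq_right_iff, not_or, Classical.not_imp] at h1 h2
    exact h2.1.1.2.trans h1.1.1.1
  · intro i a c h1 h2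
    simp only [gL, ne_eq, mul_eq_zero, ite_eq_right_iff, not_or, Classical.not_imp] at h1 h2
    exact (h2.2.1.2 i rfl).trans h1.2.1.1

end YoungDiagram

namespace SSYTN

open YoungDiagram

/-- The diagram formed by the cells of a tableau whose entries are at most `N`. -/
def shapeLE {M : ℕ} {μ : YoungDiagram} (N : ℕ) (T : SSYTN M μ) : YoungDiagram where
  cells := μ.cells.filter fun c => T.1 c.1 c.2 ≤ N
  isLowerSet := by
    rintro ⟨i, j⟩ ⟨i', j'⟩ ⟨hi, hj⟩ h
    simp only [Finset.coe_filter, mem_cells, Set.mem_ofPred_eq] at h ⊢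
    have h1 : (i', j) ∈ μ := μ.up_left_mem hi le_rfl h.1
    exact ⟨μ.up_left_mem hi hj h.1,
      ((T.1.row_weak_of_le hj h1).trans (T.1.col_weak hi h.1)).trans h.2⟩

theorem mem_shapeLE {M N : ℕ} {μ : YoungDiagram} {T : SSYTN M μ} {i j : ℕ} :
    (i, j) ∈ shapeLE N T ↔ (i, j) ∈ μ ∧ T.1 i j ≤ N := by
  rw [← mem_cells]
  simp [shapeLE]

theorem hStrip_shapeLE {N : ℕ} {μ : YoungDiagram} (T : SSYTN (N + 1) μ) :
    HStrip (shapeLE N T) μ := by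
  rw [hStrip_iff_mem]
  refine ⟨?_, fun i j hij => ?_⟩
  · rintro ⟨i, j⟩ h
    exact (mem_shapeLE.1 h).1
  · have h1 := T.1.col_strict (Nat.lt_add_one i) hij
    have h2 := (Finset.mem_Icc.1 (T.2 _ _ hij)).2
    exact mem_shapeLE.2 ⟨μ.up_left_mem i.le_succ le_rfl hij, by omega⟩

/-- Tableaux with entries at most `N + 1` whose entries at most `N` form the shape `ν` correspond
to tableaux of shape `ν` with entries at most `N`. -/
def fiberEquiv {N : ℕ} {ν μ : YoungDiagram} (h : HStrip ν μ) :
    {T : SSYTN (N + 1) μ // shapeLE N T = ν} ≃ SSYTN N ν where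
  toFun T :=
    have hT : ∀ {i j}, (i, j) ∈ ν → (i, j) ∈ μ ∧ T.1.1 i j ≤ N := fun hij =>
      mem_shapeLE.1 (T.2.symm ▸ hij)
    ⟨{ entry := fun i j => if (i, j) ∈ ν then T.1.1 i j else 0
       row_weak' := fun {i j1 j2} hj hc => by
        rw [if_pos hc, if_pos (ν.up_left_mem le_rfl hj.le hc)]
        exact T.1.1.row_weak hj (hT hc).1
       col_strict' := fun {i1 i2 j} hi hc => by
        rw [if_pos hc, if_pos (ν.up_left_mem hi.le le_rfl hc)]
        exact T.1.1.col_strict hi (hT hc).1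
       zeros' := fun hc => if_neg hc },
      fun i j hij => by
        change (if (i, j) ∈ ν then T.1.1 i j else 0) ∈ _
        rw [if_pos hij]
        exact Finset.mem_Icc.2 ⟨(Finset.mem_Icc.1 (T.1.2 i j (hT hij).1)).1, (hT hij).2⟩⟩
  invFun U :=
    have hU : ∀ {i j}, (i, j) ∈ ν → U.1 i j ≤ N := fun hij => (Finset.mem_Icc.1 (U.2 _ _ hij)).2
    let T : SSYTN (N + 1) μ :=
      ⟨{ entry := fun i j => if (i, j) ∈ ν then U.1 i j else if (i, j) ∈ μ then N + 1 else 0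
         row_weak' := fun {i j1 j2} hj hc => by
          by_cases h2 : (i, j2) ∈ ν
          · rw [if_pos h2, if_pos (ν.up_left_mem le_rfl hj.le h2)]
            exact U.1.row_weak hj h2
          · rw [if_neg h2, if_pos hc]
            split_ifs with h3
            · exact (hU h3).trans N.le_succ
            · exact le_rfl
            · exact Nat.zero_le _
         col_strict' := fun {i1 i2 j} hi hc => by
          by_cases h2 : (i2, j) ∈ ν
          · rw [if_pos h2, if_pos (ν.up_left_mem hi.le le_rfl h2)]
            exact U.1.col_strict hi h2
          · have h3 : (i1, j) ∈ ν := (hStrip_iff_mem.1 h).2 i1 j (μ.up_left_mem hi le_rfl hc)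
            rw [if_neg h2, if_pos hc, if_pos h3]
            exact Nat.lt_succ_of_le (hU h3)
         zeros' := fun {i j} hc => by
          rw [if_neg fun h' => hc (h.le h'), if_neg hc] },
        fun i j hij => by
          change (if (i, j) ∈ ν then U.1 i j else if (i, j) ∈ μ then N + 1 else 0) ∈ _
          split_ifs with h3
          · exact Finset.Icc_subset_Icc_right N.le_succ (U.2 i j h3)
          · simp⟩
    have hTe : ∀ i j, T.1 i j = if (i, j) ∈ ν then U.1 i j else if (i, j) ∈ μ then N + 1 else 0 :=
      fun i j => rfl
    ⟨T, by
      ext ⟨i, j⟩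
      rw [mem_cells, mem_cells, mem_shapeLE, hTe]
      constructor
      · rintro ⟨h1, h2⟩
        by_contra h3
        rw [if_neg h3, if_pos h1] at h2
        omega
      · intro h1
        rw [if_pos h1]
        exact ⟨h.le h1, hU h1⟩⟩
  left_inv T := by
    refine Subtype.ext (Subtype.ext (SemistandardYoungTableau.ext fun i j => ?_))
    change (if (i, j) ∈ ν then (if (i, j) ∈ ν then T.1.1 i j else 0) else
      if (i, j) ∈ μ then N + 1 else 0) = T.1.1 i j
    have h1 : (i, j) ∈ ν ↔ (i, j) ∈ μ ∧ T.1.1 i j ≤ N := by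
      rw [← mem_shapeLE, T.2]
    split_ifs with h2 h3
    · rfl
    · have := (Finset.mem_Icc.1 (T.1.2 i j h3)).2
      have : ¬ T.1.1 i j ≤ N := fun h4 => h2 (h1.2 ⟨h3, h4⟩)
      omega
    · exact (T.1.1.zeros h3).symm
  right_inv U := by
    refine Subtype.ext (SemistandardYoungTableau.ext fun i j => ?_)
    change (if (i, j) ∈ ν then (if (i, j) ∈ ν then U.1 i j else
      if (i, j) ∈ μ then N + 1 else 0) else 0) = U.1 i j
    split_ifs with h2
    · rfl
    · exact (U.1.zeros h2).symm

instance finite (N : ℕ) (μ : YoungDiagram) : Finite (SSYTN N μ) := by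
  let F : SSYTN N μ → μ.cells → Fin (N + 1) := fun T c =>
    ⟨T.1 c.1.1 c.1.2, Nat.lt_succ_of_le (Finset.mem_Icc.1 (T.2 _ _ c.2)).2⟩
  refine Finite.of_injective F fun T U h => ?_
  refine Subtype.ext (SemistandardYoungTableau.ext fun i j => ?_)
  by_cases hij : (i, j) ∈ μ
  · exact congrArg Fin.val (congrFun h ⟨(i, j), hij⟩)
  · rw [T.1.zeros hij, U.1.zeros hij]

end SSYTN

namespace YoungDiagram

instance finite_le (μ : YoungDiagram) : Finite {ν : YoungDiagram // ν ≤ μ} := by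
  let F : {ν : YoungDiagram // ν ≤ μ} → μ.cells.powerset := fun ν =>
    ⟨ν.1.cells, Finset.mem_powerset.2 (cells_subset_iff.2 ν.2)⟩
  refine Finite.of_injective F fun ν κ h => ?_
  exact Subtype.ext (YoungDiagram.ext (congrArg Subtype.val h))

theorem dCount_zero (μ : YoungDiagram) : dCount 0 μ = if μ = ⊥ then 1 else 0 := by
  split_ifs with h
  · subst h
    rw [dCount, Nat.card_eq_one_iff_unique]
    refine ⟨⟨fun T U => Subtype.ext (SemistandardYoungTableau.ext fun i j => ?_)⟩,
      ⟨⟨default, fun i j hij => (notMem_bot _ hij).elim⟩⟩⟩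
    rw [T.1.zeros (notMem_bot _), U.1.zeros (notMem_bot _)]
  · rw [dCount, Nat.card_eq_zero]
    refine Or.inl ⟨fun T => h ?_⟩
    refine YoungDiagram.ext (Finset.eq_empty_of_forall_notMem ?_)
    rintro ⟨i, j⟩ hij
    simpa using T.2 i j hij

/-- The branching rule for semistandard Young tableaux. -/
theorem dCount_succ (N : ℕ) (μ : YoungDiagram) :
    (dCount (N + 1) μ : ℝ≥0∞) = ∑' ν, if HStrip ν μ then (dCount N ν : ℝ≥0∞) else 0 := by
  have hfin : Finite {ν // HStrip ν μ} :=
    Finite.of_injective (fun ν => (⟨ν.1, ν.2.le⟩ : {ν // ν ≤ μ})) fun ν κ h => by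
      simpa [Subtype.ext_iff] using h
  have := Fintype.ofFinite {ν // HStrip ν μ}
  let f : SSYTN (N + 1) μ → {ν // HStrip ν μ} := fun T => ⟨T.shapeLE N, T.hStrip_shapeLE⟩
  have h1 : dCount (N + 1) μ = ∑ ν : {ν // HStrip ν μ}, dCount N ν.1 := by
    rw [dCount, Nat.card_congr (Equiv.sigmaFiberEquiv f).symm, Nat.card_sigma]
    refine Finset.sum_congr rfl fun ν _ => Nat.card_congr ?_
    refine (Equiv.subtypeEquivRight fun T => ?_).trans (SSYTN.fiberEquiv ν.2)
    simp [f, Subtype.ext_iff]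
  rw [h1, Nat.cast_sum, ← tsum_fintype (L := .unconditional _)]
  refine (tsum_subtype {ν | HStrip ν μ} fun ν => (dCount N ν : ℝ≥0∞)).trans ?_
  simp [Set.indicator_apply]

/-- The principally specialized Schur function `s_μ(x, …, x)` in `N` variables. -/
def schur (x : ℝ≥0∞) (N : ℕ) (μ : YoungDiagram) : ℝ≥0∞ :=
  x ^ μ.card * dCount N μ

theorem card_bot : (⊥ : YoungDiagram).card = 0 := rfl

theorem schur_zero (x : ℝ≥0∞) (μ : YoungDiagram) : schur x 0 μ = if μ = ⊥ then 1 else 0 := by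
  rw [schur, dCount_zero]
  split_ifs with h
  · subst h
    simp [card_bot]
  · simp

theorem schur_succ (x : ℝ≥0∞) (N : ℕ) (μ : YoungDiagram) :
    schur x (N + 1) μ = ∑' ν, hWeight x ν μ * schur x N ν := by
  rw [schur, dCount_succ, ← ENNReal.tsum_mul_left]
  refine tsum_congr fun ν => ?_
  rw [hWeight, schur, ite_mul, zero_mul, mul_ite, mul_zero]
  refine ite_congr rfl (fun h => ?_) fun _ => rfl
  rw [← mul_assoc, ← pow_add, Nat.sub_add_cancel (card_le_of_le h.le)]

theorem hStrip_refl (μ : YoungDiagram) : HStrip μ μ :=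
  fun i => ⟨μ.rowLen_anti i (i + 1) i.le_succ, le_rfl⟩

theorem tsum_mul_schur_zero (x : ℝ≥0∞) (F : YoungDiagram → ℝ≥0∞) :
    ∑' μ, F μ * schur x 0 μ = F ⊥ := by
  rw [tsum_eq_single ⊥ fun μ hμ => by rw [schur_zero, if_neg hμ, mul_zero], schur_zero,
    if_pos rfl, mul_one]

/-- The Pieri rule for complete homogeneous symmetric functions. -/
theorem tsum_hWeight_mul_schur (z x : ℝ≥0∞) (N : ℕ) (ν : YoungDiagram) :
    ∑' μ, hWeight z ν μ * schur x N μ = ((1 - z * x)⁻¹) ^ N * schur x N ν := by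
  induction N generalizing ν with
  | zero =>
    rw [tsum_mul_schur_zero, pow_zero, one_mul, schur_zero, hWeight]
    by_cases h : ν = ⊥
    · subst h
      simp [hStrip_refl]
    · rw [if_neg h, if_neg fun h' => h (le_bot_iff.1 h'.le)]
  | succ N ih =>
    calc ∑' μ, hWeight z ν μ * schur x (N + 1) μ
        = ∑' κ, (∑' μ, hWeight z ν μ * hWeight x κ μ) * schur x N κ := by
          simp_rw [schur_succ, ← ENNReal.tsum_mul_left, ← ENNReal.tsum_mul_right]
          rw [ENNReal.tsum_comm]
          simp_rw [mul_assoc]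
      _ = (1 - z * x)⁻¹ * ∑' κ, hWeight x κ ν * ∑' μ, hWeight z κ μ * schur x N μ := by
          simp_rw [tsum_hWeight_mul_hWeight, mul_assoc, ENNReal.tsum_mul_left,
            ← ENNReal.tsum_mul_left, ← ENNReal.tsum_mul_right]
          rw [ENNReal.tsum_comm]
          simp_rw [mul_assoc, ENNReal.tsum_mul_left]
      _ = _ := by
          simp_rw [ih, schur_succ x N ν, mul_left_comm, ENNReal.tsum_mul_left, pow_succ]
          ring

/-- The Pieri rule for elementary symmetric functions. -/
theorem tsum_vWeight_mul_schur (y x : ℝ≥0∞) (N : ℕ) (ν : YoungDiagram) :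
    ∑' μ, vWeight y ν μ * schur x N μ = (1 + x * y) ^ N * schur x N ν := by
  induction N generalizing ν with
  | zero =>
    rw [tsum_mul_schur_zero, pow_zero, one_mul, schur_zero, vWeight]
    by_cases h : ν = ⊥
    · subst h
      have : VStrip ⊥ ⊥ := fun i => ⟨le_rfl, Nat.le_succ _⟩
      simp [this]
    · rw [if_neg h, if_neg fun h' => h (le_bot_iff.1 h'.le)]
  | succ N ih =>
    calc ∑' μ, vWeight y ν μ * schur x (N + 1) μ
        = ∑' κ, (∑' μ, vWeight y ν μ * hWeight x κ μ) * schur x N κ := by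
          simp_rw [schur_succ, ← ENNReal.tsum_mul_left, ← ENNReal.tsum_mul_right]
          rw [ENNReal.tsum_comm]
          simp_rw [mul_assoc]
      _ = (1 + x * y) * ∑' κ, hWeight x κ ν * ∑' μ, vWeight y κ μ * schur x N μ := by
          simp_rw [tsum_vWeight_mul_hWeight, mul_assoc, ENNReal.tsum_mul_left,
            ← ENNReal.tsum_mul_left, ← ENNReal.tsum_mul_right]
          rw [ENNReal.tsum_comm]
          simp_rw [mul_assoc, ENNReal.tsum_mul_left]
      _ = _ := by
          simp_rw [ih, schur_succ x N ν, mul_left_comm, ENNReal.tsum_mul_left, pow_succ]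
          ring

/-- The Littlewood identity counting odd columns, in the principal specialization. -/
theorem tsum_schur_mul_pow_oddCols (x : ℝ≥0∞) {β : ℝ≥0∞} (hβ : β ≠ 0) (hβ' : β ≠ ∞) (N : ℕ) :
    ∑' μ, schur x N μ * β ^ oddCols μ =
      ((1 - β * x)⁻¹) ^ N * ((1 - x * x)⁻¹) ^ (N * (N - 1) / 2) := by
  induction N with
  | zero =>
    simp_rw [mul_comm (schur _ _ _)]
    rw [tsum_mul_schur_zero]
    simp [oddCols, card_bot]
  | succ N ih =>
    have hN : (N + 1) * (N + 1 - 1) / 2 = N + N * (N - 1) / 2 := by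
      rw [← Finset.sum_range_id_mul_two, ← Finset.sum_range_id_mul_two]
      rw [Nat.mul_div_cancel _ two_pos, Nat.mul_div_cancel _ two_pos, Finset.sum_range_succ,
        add_comm]
    calc ∑' μ, schur x (N + 1) μ * β ^ oddCols μ
        = ∑' κ, (∑' μ, hWeight x κ μ * β ^ oddCols μ) * schur x N κ := by
          simp_rw [schur_succ, ← ENNReal.tsum_mul_right]
          rw [ENNReal.tsum_comm]
          simp_rw [mul_right_comm]
      _ = (1 - β * x)⁻¹ * ∑' μ, β ^ oddCols μ * ∑' κ, hWeight x μ κ * schur x N κ := by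
          simp_rw [tsum_hWeight_mul_pow_oddCols x hβ hβ', mul_assoc, ENNReal.tsum_mul_left,
            ← ENNReal.tsum_mul_left, ← ENNReal.tsum_mul_right]
          rw [ENNReal.tsum_comm]
          simp_rw [← ENNReal.tsum_mul_left]
          exact tsum_congr fun _ => tsum_congr fun _ => by ring
      _ = (1 - β * x)⁻¹ * (((1 - x * x)⁻¹) ^ N * ∑' μ, schur x N μ * β ^ oddCols μ) := by
          simp_rw [tsum_hWeight_mul_schur, ← ENNReal.tsum_mul_left]
          refine tsum_congr fun μ => ?_
          ring
      _ = _ := by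
          rw [ih, hN, pow_add, pow_succ]
          ring

end YoungDiagram

theorem Finset.sum_pow_mul_periodic_reflect {R : Type*} [CommSemiring R] {y C : R} {p e : ℕ → R}
    (hp : ∀ k, p (k + 2) = p k) (he : ∀ k, e (k + 2) = e k)
    (h : ∀ k, (p k + y * p (k + 1)) * e k = C) (a m : ℕ) :
    (∑ k ∈ Finset.range (m + 1), y ^ k * p (a + k)) * e a =
      (∑ k ∈ Finset.range (m + 1), y ^ (m - k) * p (a + k)) * e (a + m) := by
  induction m using Nat.twoStepInduction with
  | zero => simp
  | one =>
    have h1 := h (a + 1)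
    rw [hp] at h1
    simp only [Finset.sum_range_succ, Finset.range_zero, Finset.sum_empty, pow_zero, pow_one,
      one_mul, zero_add, add_zero, Nat.sub_self, Nat.sub_zero]
    rw [h a, ← h1, add_comm]
  | more m ih _ =>
    have h1 : ∑ k ∈ Finset.range (m + 2 + 1), y ^ k * p (a + k) =
        y ^ 2 * (∑ k ∈ Finset.range (m + 1), y ^ k * p (a + k)) + (p a + y * p (a + 1)) := by
      rw [Finset.sum_range_succ', Finset.sum_range_succ', Finset.mul_sum, add_assoc]
      congr 1
      · refine Finset.sum_congr rfl fun k _ => ?_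
        rw [show a + (k + 1 + 1) = a + k + 2 by ring, hp]
        ring
      · simp [add_comm]
    have h2 : ∑ k ∈ Finset.range (m + 2 + 1), y ^ (m + 2 - k) * p (a + k) =
        y ^ 2 * (∑ k ∈ Finset.range (m + 1), y ^ (m - k) * p (a + k)) +
          (p (a + m) + y * p (a + m + 1)) := by
      rw [Finset.sum_range_succ, Finset.sum_range_succ, Finset.mul_sum, add_assoc]
      congr 1
      · refine Finset.sum_congr rfl fun k hk => ?_
        rw [Finset.mem_range] at hk
        rw [show m + 2 - k = 2 + (m - k) by omega, pow_add]
        ring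
      · rw [show m + 2 - (m + 1) = 1 by omega, Nat.sub_self, show a + (m + 2) = a + m + 2 by ring,
          hp, pow_one, pow_zero, one_mul, add_comm, add_assoc]
    rw [h1, h2, add_mul _ (p a + _), add_mul _ (p (a + m) + _), h,
      show a + (m + 2) = a + m + 2 by ring, he, h, mul_assoc, ih, mul_assoc]

namespace YoungDiagram

theorem vWeight_eq_hWeight_transpose (x : ℝ≥0∞) (ν μ : YoungDiagram) :
    vWeight x ν μ = hWeight x ν.transpose μ.transpose := by
  rw [vWeight, hWeight, card_transpose, card_transpose]
  exact ite_congr (propext vStrip_iff_hStrip_transpose) (fun _ => rfl) fun _ => rfl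

theorem tsum_vWeight_mul_pow_oddCols (y β : ℝ≥0∞) {μ : YoungDiagram} {n : ℕ}
    (hn : μ.colLen n = 0) :
    ∑' ν, vWeight y ν μ * β ^ oddCols ν =
      ∏ i ∈ Finset.range n, ∑ a ∈ Finset.Icc (μ.colLen (i + 1)) (μ.colLen i),
        y ^ (μ.colLen i - a) * if Odd a then β else 1 := by
  have h : ∀ ν, vWeight y ν μ * β ^ oddCols ν = if ν.colLen n = 0 then
      ∏ i ∈ Finset.range n, (if μ.colLen (i + 1) ≤ ν.colLen i ∧ ν.colLen i ≤ μ.colLen i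
          then y ^ (μ.colLen i - ν.colLen i) else 0) * (if Odd (ν.colLen i) then β else 1)
      else 0 := by
    intro ν
    rw [vWeight_eq_hWeight_transpose, hWeight_eq_prod_of_upper (n := n) (by rwa [rowLen_transpose]),
      ite_mul, zero_mul]
    simp only [rowLen_transpose]
    refine ite_congr rfl (fun h => ?_) fun _ => rfl
    rw [pow_oddCols_eq_prod_cols h, Finset.prod_mul_distrib]
  simp_rw [h]
  rw [tsum_prod_colLen n fun i a =>
    (if μ.colLen (i + 1) ≤ a ∧ a ≤ μ.colLen i then y ^ (μ.colLen i - a) else 0) *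
      (if Odd a then β else 1)]
  · refine Finset.prod_congr rfl fun i _ => ?_
    rw [← ENNReal.tsum_ite_Icc]
    exact tsum_congr fun a => by rw [ite_mul, zero_mul]
  · intro i a c h1 h2
    simp only [ne_eq, mul_eq_zero, ite_eq_right_iff, not_or, Classical.not_imp] at h1 h2
    exact h2.1.1.2.trans h1.1.1.1

/-- Inverting the strip weight while removing vertical strips gains a power of the number of
rows. -/
theorem mul_tsum_vWeight_le {y w β : ℝ≥0∞} (hyw : y * w = 1) (hy : y ≤ 1) (hβ' : β ≠ ∞)
    (μ : YoungDiagram) :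
    y * ∑' ν, vWeight y ν μ * β ^ oddCols ν ≤
      y ^ numRows μ * ∑' ν, vWeight w ν μ * β ^ oddCols ν := by
  obtain ⟨n, hn⟩ : ∃ n, μ.colLen n = 0 := ⟨_, colLen_eq_zero_iff.2 le_rfl⟩
  rw [tsum_vWeight_mul_pow_oddCols y β hn, tsum_vWeight_mul_pow_oddCols w β hn]
  have hy0 : y ≠ 0 := by
    rintro rfl
    simp at hyw
  have hanti : ∀ i, μ.colLen (i + 1) ≤ μ.colLen i := fun i => μ.colLen_anti i (i + 1) i.le_succ
  let p : ℕ → ℝ≥0∞ := fun k => if Odd k then β else 1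
  let e : ℕ → ℝ≥0∞ := fun k => if Odd k then 1 + β * y else β + y
  have hp : ∀ k, p (k + 2) = p k := fun k => by simp [p, Nat.odd_add]
  have he : ∀ k, e (k + 2) = e k := fun k => by simp [e, Nat.odd_add]
  have hC : ∀ k, (p k + y * p (k + 1)) * e k = (1 + β * y) * (β + y) := by
    intro k
    by_cases h : Odd k
    · simp [p, e, h, Nat.odd_add_one, mul_comm]
    · simp [p, e, h, Nat.odd_add_one, mul_comm]
  let T : ℕ → ℝ≥0∞ := fun i => ∑ a ∈ Finset.Icc (μ.colLen (i + 1)) (μ.colLen i),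
    y ^ (μ.colLen i - a) * p a
  let U : ℕ → ℝ≥0∞ := fun i => ∑ a ∈ Finset.Icc (μ.colLen (i + 1)) (μ.colLen i),
    w ^ (μ.colLen i - a) * p a
  have hTU : ∀ i, y ^ (μ.colLen i - μ.colLen (i + 1)) * U i * e (μ.colLen (i + 1)) =
      T i * e (μ.colLen i) := by
    intro i
    obtain ⟨m, hm⟩ := Nat.exists_eq_add_of_le (hanti i)
    have hIcc : ∀ F : ℕ → ℝ≥0∞, ∑ a ∈ Finset.Icc (μ.colLen (i + 1)) (μ.colLen i), F a =
        ∑ k ∈ Finset.range (m + 1), F (μ.colLen (i + 1) + k) := by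
      intro F
      rw [← Finset.Ico_add_one_right_eq_Icc, Finset.sum_Ico_eq_sum_range, hm]
      congr 2
      omega
    simp only [T, U]
    rw [hIcc, hIcc, Finset.mul_sum]
    simp only [hm, Nat.add_sub_add_left, Nat.add_sub_cancel_left]
    rw [← Finset.sum_pow_mul_periodic_reflect hp he hC]
    congr 1
    refine Finset.sum_congr rfl fun k hk => ?_
    rw [Finset.mem_range] at hk
    nth_rw 1 [show m = k + (m - k) by omega]
    rw [pow_add, ← mul_assoc, mul_assoc (y ^ k), ← mul_pow, hyw, one_pow, mul_one]
  have hprod : ∀ k, y ^ (μ.colLen 0 - μ.colLen k) * (∏ i ∈ Finset.range k, U i) *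
      e (μ.colLen k) = (∏ i ∈ Finset.range k, T i) * e (μ.colLen 0) := by
    intro k
    induction k with
    | zero => simp
    | succ k ih =>
      have h1 : μ.colLen 0 - μ.colLen (k + 1) =
          (μ.colLen 0 - μ.colLen k) + (μ.colLen k - μ.colLen (k + 1)) := by
        have := hanti k
        have := μ.colLen_anti 0 k (Nat.zero_le k)
        omega
      rw [Finset.prod_range_succ, Finset.prod_range_succ, h1, pow_add, mul_right_comm _ (T k), ← ih]
      calc _ = y ^ (μ.colLen 0 - μ.colLen k) * (∏ i ∈ Finset.range k, U i) *
            (y ^ (μ.colLen k - μ.colLen (k + 1)) * U k * e (μ.colLen (k + 1))) := by ring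
        _ = _ := by
          rw [hTU]
          ring
  have h := hprod n
  have he0 : e 0 = β + y := by simp [e]
  rw [hn, he0, Nat.sub_zero] at h
  have hle : y * (β + y) ≤ e (μ.colLen 0) := by
    by_cases h : Odd (μ.colLen 0)
    · simp only [e, if_pos h]
      rw [mul_add, add_comm, mul_comm y β]
      exact add_le_add_left (mul_le_one' hy hy) _
    · simp only [e, if_neg h]
      exact mul_le_of_le_one_left' hy
  have hne : β + y ≠ 0 := fun h => hy0 (add_eq_zero.1 h).2
  have hne' : β + y ≠ ∞ := ENNReal.add_ne_top.2 ⟨hβ', (hy.trans_lt ENNReal.one_lt_top).ne⟩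
  rw [← ENNReal.mul_le_mul_iff_left hne hne']
  refine le_of_le_of_eq ?_ h.symm
  rw [mul_right_comm, mul_comm]
  exact mul_le_mul_right hle _

/-- The exponential tail bound for the number of rows. -/
theorem tsum_tail_le {x y w β : ℝ≥0∞} (hyw : y * w = 1) (hy : y ≤ 1) (hβ' : β ≠ ∞) (N l : ℕ) :
    (1 + x * y) ^ N * ∑' ν, (if l < numRows ν then schur x N ν * β ^ oddCols ν else 0) ≤
      y ^ l * ((1 + x * w) ^ N * ∑' ν, schur x N ν * β ^ oddCols ν) := by
  have hy0 : y ≠ 0 := by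
    rintro rfl
    simp at hyw
  have hpt : ∀ μ, (∑' ν, (if l < numRows ν then vWeight y ν μ * β ^ oddCols ν else 0)) ≤
      y ^ l * ∑' ν, vWeight w ν μ * β ^ oddCols ν := by
    intro μ
    by_cases hμ : l < numRows μ
    · have h1 : y * (∑' ν, vWeight y ν μ * β ^ oddCols ν) ≤
          y * (y ^ l * ∑' ν, vWeight w ν μ * β ^ oddCols ν) := by
        refine (mul_tsum_vWeight_le hyw hy hβ' μ).trans ?_
        rw [← mul_assoc, ← pow_succ']
        exact mul_le_mul_left (pow_le_pow_right_of_le_one' hy hμ) _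
      rw [ENNReal.mul_le_mul_iff_right hy0 (hy.trans_lt ENNReal.one_lt_top).ne] at h1
      refine le_trans (ENNReal.tsum_le_tsum fun ν => ?_) h1
      split_ifs <;> simp
    · refine le_of_eq_of_le (ENNReal.tsum_eq_zero.2 fun ν => ?_) (zero_le)
      rw [vWeight]
      split_ifs with h1 h2
      · refine absurd (h1.trans_le ?_) hμ
        have := le_iff_rowLen.1 (transpose_le_iff.2 h2.le) 0
        rwa [rowLen_transpose, rowLen_transpose] at this
      · rw [zero_mul]
      · rfl
  calc (1 + x * y) ^ N * ∑' ν, (if l < numRows ν then schur x N ν * β ^ oddCols ν else 0)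
      = ∑' ν, (if l < numRows ν then (∑' μ, vWeight y ν μ * schur x N μ) * β ^ oddCols ν
          else 0) := by
        rw [← ENNReal.tsum_mul_left]
        refine tsum_congr fun ν => ?_
        rw [mul_ite, mul_zero, tsum_vWeight_mul_schur, mul_assoc]
    _ = ∑' μ, schur x N μ * ∑' ν, (if l < numRows ν then vWeight y ν μ * β ^ oddCols ν
          else 0) := by
        simp_rw [← ENNReal.tsum_mul_left]
        rw [ENNReal.tsum_comm]
        refine tsum_congr fun ν => ?_
        split_ifs
        · rw [← ENNReal.tsum_mul_right]
          exact tsum_congr fun μ => by ring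
        · simp
    _ ≤ ∑' μ, schur x N μ * (y ^ l * ∑' ν, vWeight w ν μ * β ^ oddCols ν) :=
        ENNReal.tsum_le_tsum fun μ => mul_le_mul_right (hpt μ) _
    _ = y ^ l * ∑' ν, (∑' μ, vWeight w ν μ * schur x N μ) * β ^ oddCols ν := by
        simp_rw [← ENNReal.tsum_mul_right, ← ENNReal.tsum_mul_left]
        rw [ENNReal.tsum_comm]
        exact tsum_congr fun ν => tsum_congr fun μ => by ring
    _ = _ := by
        simp_rw [tsum_vWeight_mul_schur, mul_assoc, ENNReal.tsum_mul_left]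

end YoungDiagram

theorem Real.exp_add_exp_neg_sub_two_le {δ : ℝ} (h : |δ| ≤ 1) :
    Real.exp δ + Real.exp (-δ) - 2 ≤ 2 * δ ^ 2 := by
  have h1 := Real.cosh_le_exp_half_sq δ
  have h0 : δ ^ 2 ≤ 1 := (sq_le_one_iff_abs_le_one δ).2 h
  have h3 : |δ ^ 2 / 2| = δ ^ 2 / 2 := abs_of_nonneg (by positivity)
  have h2 := Real.abs_exp_sub_one_le (x := δ ^ 2 / 2) (by rw [h3]; linarith)
  rw [h3] at h2
  have h4 := (abs_le.1 h2).2
  rw [Real.cosh_eq] at h1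
  linarith

theorem deriv_log_ratio_le {t : ℝ} (ht : 0 < t) (ht1 : t < 1) {δ : ℝ} (hδ : 0 ≤ δ) :
    t * Real.exp δ / (1 + t * Real.exp δ) + t * Real.exp (-δ) / (1 + t * Real.exp (-δ)) ≤
      etaT t + 3 * δ ^ 2 := by
  have ha := Real.exp_pos δ
  have hb := Real.exp_pos (-δ)
  have hab : Real.exp δ * Real.exp (-δ) = 1 := by rw [← Real.exp_add]; simp
  have hs : 2 ≤ Real.exp δ + Real.exp (-δ) := by
    nlinarith [sq_nonneg (Real.exp δ - Real.exp (-δ))]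
  have hδs : δ ≤ 1 → Real.exp δ + Real.exp (-δ) - 2 ≤ 2 * δ ^ 2 := fun h =>
    Real.exp_add_exp_neg_sub_two_le (by rwa [abs_of_nonneg hδ])
  generalize Real.exp δ = a at *
  generalize Real.exp (-δ) = b at *
  have hD : 0 < 1 + t * (a + b) + t ^ 2 := by positivity
  have h1 : t * a / (1 + t * a) + t * b / (1 + t * b) =
      etaT t + t * (1 - t) * (a + b - 2) / ((1 + t) * (1 + t * (a + b) + t ^ 2)) := by
    have h2 : (1 + t * a) * (1 + t * b) = 1 + t * (a + b) + t ^ 2 := by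
      linear_combination t ^ 2 * hab
    have h3 : t * a * (1 + t * b) + (1 + t * a) * (t * b) = t * (a + b) + 2 * t ^ 2 := by
      linear_combination 2 * t ^ 2 * hab
    rw [div_add_div _ _ (by positivity) (by positivity), h2, h3, etaT,
      div_add_div _ _ (by positivity) (by positivity), div_eq_div_iff hD.ne' (by positivity)]
    ring
  rw [h1]
  refine add_le_add_right ?_ _
  rw [div_le_iff₀ (by positivity)]
  have h5 : 0 ≤ a + b - 2 := by linarith
  have h6 : t * (1 - t) ≤ 1 := by nlinarith
  rcases le_total δ 1 with h | h
  · have h7 : 1 ≤ (1 + t) * (1 + t * (a + b) + t ^ 2) := by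
      refine one_le_mul_of_one_le_of_one_le (by linarith) ?_
      nlinarith [mul_pos ht (add_pos ha hb), sq_nonneg t]
    calc t * (1 - t) * (a + b - 2) ≤ 1 * (2 * δ ^ 2) :=
          mul_le_mul h6 (hδs h) h5 zero_le_one
      _ ≤ 3 * δ ^ 2 * 1 := by nlinarith [sq_nonneg δ]
      _ ≤ _ := mul_le_mul_of_nonneg_left h7 (by positivity)
  · have h8 : 1 ≤ 3 * δ ^ 2 := by nlinarith
    calc t * (1 - t) * (a + b - 2) ≤ t * (a + b) := by nlinarith [mul_nonneg (sq_nonneg t) h5]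
      _ ≤ 1 * ((1 + t) * (1 + t * (a + b) + t ^ 2)) := by
          have := mul_pos ht (add_pos ha hb)
          nlinarith [mul_pos ht this, sq_nonneg t, mul_pos ht (sq_pos_of_pos ht)]
      _ ≤ _ := mul_le_mul_of_nonneg_right h8 (by positivity)

theorem one_add_mul_exp_le {t : ℝ} (ht : 0 < t) (ht1 : t < 1) {δ : ℝ} (hδ : 0 ≤ δ) :
    1 + t * Real.exp δ ≤
      (1 + t * Real.exp (-δ)) * Real.exp (etaT t * δ + δ ^ 3) := by
  let h : ℝ → ℝ := fun δ => etaT t * δ + δ ^ 3 -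
    (Real.log (1 + t * Real.exp δ) - Real.log (1 + t * Real.exp (-δ)))
  have hp : ∀ z, 0 < 1 + t * Real.exp z := fun z => by positivity
  have hd : ∀ z, HasDerivAt h (etaT t + 3 * z ^ 2 - (t * Real.exp z / (1 + t * Real.exp z) +
      t * Real.exp (-z) / (1 + t * Real.exp (-z)))) z := by
    intro z
    have h1 : HasDerivAt (fun z => Real.log (1 + t * Real.exp z))
        (t * Real.exp z / (1 + t * Real.exp z)) z :=
      (((Real.hasDerivAt_exp z).const_mul t).const_add 1).log (hp z).ne'
    have h2 : HasDerivAt (fun z => Real.log (1 + t * Real.exp (-z)))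
        (t * (Real.exp (-z) * -1) / (1 + t * Real.exp (-z))) z :=
      ((((hasDerivAt_neg z).exp).const_mul t).const_add 1).log (hp (-z)).ne'
    have h3 : HasDerivAt (fun z => etaT t * z + z ^ 3) (etaT t * 1 + 3 * z ^ 2) z := by
      exact ((hasDerivAt_id z).const_mul (etaT t)).add (hasDerivAt_pow 3 z)
    refine (h3.sub (h1.sub h2)).congr_deriv ?_
    ring
  have hmono : MonotoneOn h (Set.Ici 0) := by
    refine monotoneOn_of_deriv_nonneg (convex_Ici 0)
      (fun z _ => (hd z).continuousAt.continuousWithinAt)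
      (fun z _ => (hd z).differentiableAt.differentiableWithinAt) fun z hz => ?_
    rw [interior_Ici] at hz
    rw [(hd z).deriv]
    exact sub_nonneg.2 (deriv_log_ratio_le ht ht1 (le_of_lt hz))
  have h0 := hmono Set.self_mem_Ici hδ hδ
  simp only [h] at h0
  simp only [mul_zero, ne_eq, OfNat.ofNat_ne_zero, not_false_eq_true, zero_pow, add_zero,
    neg_zero, sub_self] at h0
  rw [← Real.log_le_log_iff (hp δ) (mul_pos (hp _) (Real.exp_pos _)),
    Real.log_mul (hp _).ne' (Real.exp_pos _).ne', Real.log_exp]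
  linarith

theorem ENNReal.ofReal_one_sub_inv {z : ℝ} (hz : 0 ≤ z) (hz1 : z < 1) :
    (1 - ENNReal.ofReal z)⁻¹ = ENNReal.ofReal (1 - z)⁻¹ := by
  rw [ENNReal.ofReal_inv_of_pos (by linarith), ENNReal.ofReal_sub _ hz, ENNReal.ofReal_one]

open YoungDiagram in
/-- The Chernoff-type bound for the right tail of `phiGF`. -/
theorem one_sub_phiGF_bounds {t β : ℝ} (ht : 0 < t) (ht1 : t < 1) (hβ : 0 < β) (hβt : β * t < 1)
    (N l : ℕ) {y : ℝ} (hy : 0 < y) (hy1 : y ≤ 1) :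
    0 ≤ 1 - phiGF N l t β ∧
      (1 - phiGF N l t β) * (1 + t * y) ^ N ≤ y ^ l * (1 + t * y⁻¹) ^ N := by
  let F : YoungDiagram → ℝ≥0∞ := fun μ =>
    schur (ENNReal.ofReal t) N μ * ENNReal.ofReal β ^ oddCols μ
  let Z : ℝ := (1 - t ^ 2) ^ (N * (N - 1) / 2) * (1 - β * t) ^ N
  have hZ : 0 < Z := by
    have h1 : 0 < 1 - t ^ 2 := by nlinarith
    have h2 : 0 < 1 - β * t := by linarith
    positivity
  have hE : ∑' μ, F μ = ENNReal.ofReal Z⁻¹ := by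
    simp only [F]
    rw [tsum_schur_mul_pow_oddCols _ (by simpa using hβ) ENNReal.ofReal_ne_top,
      ← ENNReal.ofReal_mul hβ.le, ← ENNReal.ofReal_mul ht.le,
      ENNReal.ofReal_one_sub_inv (by positivity) hβt,
      ENNReal.ofReal_one_sub_inv (by positivity) (by nlinarith),
      ← ENNReal.ofReal_pow (inv_nonneg.2 (by linarith)),
      ← ENNReal.ofReal_pow (inv_nonneg.2 (by nlinarith)),
      ← ENNReal.ofReal_mul (pow_nonneg (inv_nonneg.2 (by linarith)) _)]
    simp only [Z, mul_inv, inv_pow, sq]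
    rw [mul_comm]
  let S : ℝ≥0∞ := ∑' μ, if numRows μ ≤ l then F μ else 0
  let R : ℝ≥0∞ := ∑' μ, if l < numRows μ then F μ else 0
  have hSR : S + R = ENNReal.ofReal Z⁻¹ := by
    rw [← hE, ← ENNReal.tsum_add]
    refine tsum_congr fun μ => ?_
    rcases le_or_gt (numRows μ) l with h | h
    · rw [if_pos h, if_neg h.not_gt, add_zero]
    · rw [if_neg h.not_ge, if_pos h, zero_add]
  have hS : S ≠ ∞ := fun h => ENNReal.ofReal_ne_top (hSR.symm.trans (by rw [h, top_add]))
  have hR : R ≠ ∞ := fun h => ENNReal.ofReal_ne_top (hSR.symm.trans (by rw [h, add_top]))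
  have hphi : phiGF N l t β = Z * S.toReal := by
    have h1 : S = ∑' μ : {μ : YoungDiagram // numRows μ ≤ l}, F μ.1 := by
      refine Eq.trans ?_ (tsum_subtype {μ | numRows μ ≤ l} F).symm
      simp [S, Set.indicator_apply]
    have hFtop : ∀ μ, F μ ≠ ∞ := fun μ h =>
      (ENNReal.ofReal_ne_top : ENNReal.ofReal Z⁻¹ ≠ ∞)
        (top_le_iff.1 (by rw [← hE, ← h]; exact ENNReal.le_tsum μ))
    rw [phiGF, h1,
      ENNReal.tsum_toReal_eq fun μ : {μ : YoungDiagram // numRows μ ≤ l} => hFtop μ.1]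
    congr 1
    refine tsum_congr fun μ => ?_
    simp only [F, schur, ENNReal.toReal_mul, ENNReal.toReal_pow, ENNReal.toReal_ofReal ht.le,
      ENNReal.toReal_ofReal hβ.le, ENNReal.toReal_natCast]
    ring
  have hSR' : S.toReal + R.toReal = Z⁻¹ := by
    rw [← ENNReal.toReal_add hS hR, hSR, ENNReal.toReal_ofReal (inv_nonneg.2 hZ.le)]
  have hval : 1 - phiGF N l t β = Z * R.toReal := by
    rw [hphi, ← mul_inv_cancel₀ hZ.ne', ← hSR']
    ring
  have htail := tsum_tail_le (x := ENNReal.ofReal t) (y := ENNReal.ofReal y)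
    (w := ENNReal.ofReal y⁻¹) (β := ENNReal.ofReal β)
    (by rw [← ENNReal.ofReal_mul hy.le, mul_inv_cancel₀ hy.ne', ENNReal.ofReal_one])
    (ENNReal.ofReal_le_one.2 hy1) ENNReal.ofReal_ne_top N l
  change _ * R ≤ _ * (_ * ∑' ν, F ν) at htail
  rw [hE] at htail
  have htail' := ENNReal.toReal_mono (by finiteness) htail
  have hyi : 0 ≤ y⁻¹ := inv_nonneg.2 hy.le
  rw [← ENNReal.ofReal_mul ht.le, ← ENNReal.ofReal_mul ht.le] at htail'
  simp only [ENNReal.toReal_mul, ENNReal.toReal_pow, ENNReal.toReal_ofReal hy.le,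
    ENNReal.toReal_ofReal (inv_nonneg.2 hZ.le),
    ENNReal.toReal_add ENNReal.one_ne_top ENNReal.ofReal_ne_top, ENNReal.toReal_one,
    ENNReal.toReal_ofReal (mul_nonneg ht.le hy.le),
    ENNReal.toReal_ofReal (mul_nonneg ht.le hyi)] at htail'
  rw [hval]
  refine ⟨mul_nonneg hZ.le ENNReal.toReal_nonneg, ?_⟩
  calc Z * R.toReal * (1 + t * y) ^ N = Z * ((1 + t * y) ^ N * R.toReal) := by ring
    _ ≤ Z * (y ^ l * ((1 + t * y⁻¹) ^ N * Z⁻¹)) := mul_le_mul_of_nonneg_left htail' hZ.le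
    _ = Z * Z⁻¹ * (y ^ l * (1 + t * y⁻¹) ^ N) := by ring
    _ = _ := by rw [mul_inv_cancel₀ hZ.ne', one_mul]

theorem one_sub_phiGF_le_exp {t β : ℝ} (ht : 0 < t) (ht1 : t < 1) (hβ : 0 < β) (hβt : β * t < 1)
    (N l : ℕ) {δ : ℝ} (hδ : 0 ≤ δ) :
    1 - phiGF N l t β ≤ Real.exp (-δ * (l - etaT t * N) + N * δ ^ 3) := by
  have h1 := (one_sub_phiGF_bounds ht ht1 hβ hβt N l (Real.exp_pos (-δ))
    (Real.exp_le_one_iff.2 (neg_nonpos.2 hδ))).2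
  rw [← Real.exp_neg, neg_neg] at h1
  have h2 := pow_le_pow_left₀ (by positivity) (one_add_mul_exp_le ht ht1 hδ) N
  have hp : 0 < (1 + t * Real.exp (-δ)) ^ N := by positivity
  refine le_of_mul_le_mul_right (h1.trans ?_) hp
  calc Real.exp (-δ) ^ l * (1 + t * Real.exp δ) ^ N
      ≤ Real.exp (-δ) ^ l * ((1 + t * Real.exp (-δ)) * Real.exp (etaT t * δ + δ ^ 3)) ^ N :=
        mul_le_mul_of_nonneg_left h2 (by positivity)
    _ = Real.exp (-δ) ^ l * Real.exp (etaT t * δ + δ ^ 3) ^ N *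
          (1 + t * Real.exp (-δ)) ^ N := by rw [mul_pow]; ring
    _ = _ := by
        rw [← Real.exp_nat_mul, ← Real.exp_nat_mul, ← Real.exp_add]
        congr 2
        ring

/-- Right-tail estimate: if `x = (l - η(t)N)/(ρ(t)N^{1/3}) ≥ M₀` then
`0 ≤ 1 - φ(N,l,t,β) ≤ C e^{-c x^{3/2}}`. -/
theorem phi_right_tail (t β : ℝ) (ht : 0 < t) (ht1 : t < 1)
    (hβ : 0 < β) (hβt : β * t < 1) :
    ∃ M₀ > (0 : ℝ), ∃ C > (0 : ℝ), ∃ c > (0 : ℝ), ∀ N l : ℕ, 0 < N → 0 < l →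
      ∀ x : ℝ, x = ((l : ℝ) - etaT t * N) / (rhoT t * (N : ℝ) ^ ((1 : ℝ) / 3)) →
      M₀ ≤ x →
      0 ≤ 1 - phiGF N l t β ∧ 1 - phiGF N l t β ≤ C * Real.exp (-c * x ^ ((3 : ℝ) / 2)) := by
  have hρ : 0 < rhoT t := by
    have : 0 < 1 - t := by linarith
    rw [rhoT]
    positivity
  let s : ℝ := √(rhoT t / 2)
  have hs : 0 < s := Real.sqrt_pos.2 (by positivity)
  have hs2 : s ^ 2 = rhoT t / 2 := Real.sq_sqrt (by positivity)
  refine ⟨1, one_pos, 1, one_pos, s * rhoT t / 2, by positivity, fun N l hN _ x hx hx1 => ?_⟩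
  refine ⟨(one_sub_phiGF_bounds ht ht1 hβ hβt N l one_pos le_rfl).1, ?_⟩
  have hN' : (0 : ℝ) < N := Nat.cast_pos.2 hN
  let n : ℝ := (N : ℝ) ^ ((1 : ℝ) / 3)
  have hn : 0 < n := Real.rpow_pos_of_pos hN' _
  have hn3 : n ^ 3 = N := by
    rw [← Real.rpow_natCast, ← Real.rpow_mul hN'.le]
    norm_num
  let q : ℝ := √x
  have hx0 : 0 ≤ x := zero_le_one.trans hx1
  have hq2 : q ^ 2 = x := Real.sq_sqrt hx0
  have hq3 : x ^ ((3 : ℝ) / 2) = q ^ 3 := by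
    rw [← Real.rpow_natCast, show q = x ^ ((1 : ℝ) / 2) from Real.sqrt_eq_rpow x,
      ← Real.rpow_mul hx0]
    norm_num
  have hxl : (l : ℝ) - etaT t * N = x * (rhoT t * n) := by
    rw [hx, div_mul_cancel₀]
    positivity
  refine (one_sub_phiGF_le_exp ht ht1 hβ hβt N l (δ := s * q / n) (by positivity)).trans
    (le_of_eq ?_)
  rw [hxl, hq3, one_mul, ← hn3, ← hq2]
  congr 1
  have h1 : n ^ 3 * (s * q / n) ^ 3 = s ^ 2 * s * q ^ 3 := by
    field_simp
  have h2 : -(s * q / n) * (q ^ 2 * (rhoT t * n)) = -(s * rhoT t * q ^ 3) := by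
    field_simp
  rw [h1, h2, hs2]
  ring
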